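/- arXiv:2007.11873 — 2 statements merged into one kernel-verified Lean document; each statement's English description precedes it below -/
import Mathlib

section
/- For all integers k ≥ 0 and s ≥ 1, Σ_{i=0}^{k} 2^{k-i} Σ_{k₁+⋯+k_s = k-i, k_j ≥ 0} ζ*(i+k₁+2, k₂+2, …, k_s+2) = 2^{1+k} C(k+s-1, k) (1 - 2^{1-k-2s}) ζ(k+2s). -/
open scoped BigOperators

/-- Multiple zeta-star value ζ*, encoded with mᵢ = m i + 1. -/
noncomputable def zetaStar {n : ℕ} (k : Fin n → ℕ) : ℝ :=
  ∑' m : Fin n → ℕ, if Monotone m then ∏ i, (1 : ℝ) / ((m i + 1 : ℝ) ^ (k i)) else 0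

open PowerSeries Finset

/-- The power series of `1 / (m - c X)`. -/
noncomputable def geomSeries (c m : ℝ) : ℝ⟦X⟧ := PowerSeries.mk fun k => c ^ k / m ^ (k + 1)

/-- The power series of `1 / (m (m - 2 X))`. -/
noncomputable def starWeight (m : ℕ) : ℝ⟦X⟧ := PowerSeries.mk fun k => 2 ^ k / (m : ℝ) ^ (k + 2)

/-- The power series of `m / (m - X)`. -/
noncomputable def headWeight (m : ℕ) : ℝ⟦X⟧ := PowerSeries.mk fun k => 1 / (m : ℝ) ^ k

/-- The product over `i < n` of `(N - i) / (N + i + 1 - 2 X)`. -/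
noncomputable def connector (N n : ℕ) : ℝ⟦X⟧ :=
  ∏ i ∈ range n, ((N : ℝ⟦X⟧) - i) * geomSeries 2 (N + i + 1)

theorem geomSeries_mul (c : ℝ) {m : ℝ} (hm : m ≠ 0) :
    geomSeries c m * (C m - C c * X) = 1 := by
  ext k
  rw [mul_sub, map_sub, coeff_mul_C, mul_left_comm, coeff_C_mul]
  cases k with
  | zero => simp [geomSeries, hm]
  | succ k =>
    simp only [coeff_succ_mul_X, geomSeries, coeff_mk, coeff_one]
    field_simp
    simp
    ring

theorem geomSeries_two_mul (N n : ℕ) :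
    geomSeries 2 (N + n + 1) * ((N : ℝ⟦X⟧) + n + 1 - 2 * (X : ℝ⟦X⟧)) = 1 := by
  simpa [map_ofNat (C (R := ℝ)) 2] using geomSeries_mul 2 (m := (N + n + 1 : ℝ)) (by positivity)

theorem starWeight_mul {m : ℕ} (hm : m ≠ 0) :
    starWeight m * ((m : ℝ⟦X⟧) * (m - 2 * (X : ℝ⟦X⟧))) = 1 := by
  have hm' : (m : ℝ) ≠ 0 := by exact_mod_cast hm
  have h : starWeight m * (m : ℝ⟦X⟧) = geomSeries 2 m := by
    ext k
    rw [← map_natCast (C (R := ℝ)), coeff_mul_C]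
    simp only [starWeight, geomSeries, coeff_mk]
    field_simp
    ring
  rw [← mul_assoc, h]
  simpa [map_ofNat (C (R := ℝ)) 2] using geomSeries_mul 2 hm'

theorem headWeight_mul {m : ℕ} (hm : m ≠ 0) :
    headWeight m * ((m : ℝ⟦X⟧) - (X : ℝ⟦X⟧)) = m := by
  have hm' : (m : ℝ) ≠ 0 := by exact_mod_cast hm
  have h : headWeight m = geomSeries 1 m * (m : ℝ⟦X⟧) := by
    ext k
    rw [← map_natCast (C (R := ℝ)), coeff_mul_C]
    simp only [headWeight, geomSeries, coeff_mk]
    field_simp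
    simp [pow_succ]
  have h' : geomSeries 1 m * ((m : ℝ⟦X⟧) - (X : ℝ⟦X⟧)) = 1 := by simpa using geomSeries_mul 1 hm'
  rw [h, mul_right_comm, h', one_mul]

theorem connector_succ_right (N n : ℕ) :
    connector N (n + 1) = connector N n * (((N : ℝ⟦X⟧) - n) * geomSeries 2 (N + n + 1)) :=
  prod_range_succ _ _

theorem connector_succ_right_mul (N n : ℕ) :
    connector N (n + 1) * ((N : ℝ⟦X⟧) + n + 1 - 2 * (X : ℝ⟦X⟧)) = connector N n * ((N : ℝ⟦X⟧) - n) := by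
  rw [connector_succ_right]
  linear_combination (connector N n * ((N : ℝ⟦X⟧) - n)) * geomSeries_two_mul N n

theorem connector_eq_zero {N n : ℕ} (h : N < n) : connector N n = 0 :=
  prod_eq_zero (mem_range.2 h) (by simp)

theorem connector_succ_left_mul (N n : ℕ) :
    connector (N + 1) n * (((N : ℝ⟦X⟧) + 1 - n) * ((N : ℝ⟦X⟧) + 1 + n - 2 * (X : ℝ⟦X⟧))) =
      connector N n * (((N : ℝ⟦X⟧) + 1) * ((N : ℝ⟦X⟧) + 1 - 2 * (X : ℝ⟦X⟧))) := by
  induction n with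
  | zero => simp [connector]
  | succ n ih =>
    have h1 := connector_succ_right_mul (N + 1) n
    have h2 := geomSeries_two_mul N n
    rw [connector_succ_right N]
    push_cast at h1 ⊢
    linear_combination ((N : ℝ⟦X⟧) - n) * h1 +
      (((N : ℝ⟦X⟧) - n) * geomSeries 2 (N + n + 1)) * ih
      - (((N : ℝ⟦X⟧) - n) * connector (N + 1) n * ((N : ℝ⟦X⟧) + 1 - n)) * h2

/-- A finite form of the series `2 ∑ (-1) ^ (n - 1) / (n (n - 2 X)) ^ s`, weighted by `connector`. -/
noncomputable def alternatingSum (s N : ℕ) : ℝ⟦X⟧ :=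
  ∑ n ∈ range N, 2 * (-1) ^ n * connector N (n + 1) * starWeight (n + 1) ^ s

theorem sum_connector_mul (N M : ℕ) :
    (∑ n ∈ range M, (-1) ^ n * connector N n) * (2 * ((N : ℝ⟦X⟧) - (X : ℝ⟦X⟧))) =
      (N : ℝ⟦X⟧) - 2 * (X : ℝ⟦X⟧) - (-1) ^ M * connector N M * ((N : ℝ⟦X⟧) + M - 2 * (X : ℝ⟦X⟧)) := by
  induction M with
  | zero => simp [connector]
  | succ M ih =>
    have h := connector_succ_right_mul N M
    rw [sum_range_succ, add_mul, ih, pow_succ]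
    push_cast
    linear_combination (-(-1) ^ M) * h

theorem alternatingSum_zero {N : ℕ} (hN : N ≠ 0) : alternatingSum 0 N = headWeight N := by
  have hne : (N : ℝ⟦X⟧) - (X : ℝ⟦X⟧) ≠ 0 := by
    intro h
    have := congrArg (coeff 0) h
    rw [← map_natCast (C (R := ℝ))] at this
    simp [hN] at this
  apply mul_right_cancel₀ hne
  rw [headWeight_mul hN]
  have h := sum_connector_mul N (N + 1)
  rw [connector_eq_zero (Nat.lt_succ_self N), sum_range_succ'] at h
  have h0 : connector N 0 = 1 := by simp [connector]
  have h2 : alternatingSum 0 N =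
      -2 * ∑ n ∈ range N, (-1) ^ (n + 1) * connector N (n + 1) := by
    rw [alternatingSum, mul_sum]
    exact sum_congr rfl fun n _ => by ring
  rw [h0] at h
  rw [h2]
  linear_combination -h

theorem alternatingSum_succ_sub (s N : ℕ) :
    alternatingSum (s + 1) (N + 1) =
      alternatingSum (s + 1) N + starWeight (N + 1) * alternatingSum s (N + 1) := by
  have h : alternatingSum (s + 1) N =
      ∑ n ∈ range (N + 1), 2 * (-1) ^ n * connector N (n + 1) * starWeight (n + 1) ^ (s + 1) := by
    rw [sum_range_succ, connector_eq_zero (Nat.lt_succ_self N)]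
    simp [alternatingSum]
  rw [h, alternatingSum, alternatingSum, mul_sum, ← sum_add_distrib]
  refine sum_congr rfl fun n _ => ?_
  have h1 := connector_succ_left_mul N (n + 1)
  have h2 := starWeight_mul (Nat.succ_ne_zero N)
  have h3 := starWeight_mul (Nat.succ_ne_zero n)
  have h4 : connector (N + 1) (n + 1) * starWeight (n + 1) =
      connector N (n + 1) * starWeight (n + 1) + starWeight (N + 1) * connector (N + 1) (n + 1) := by
    push_cast at h1 h2 h3
    linear_combination (starWeight (N + 1) * starWeight (n + 1)) * h1
      - (connector (N + 1) (n + 1) * starWeight (n + 1)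
        - connector N (n + 1) * starWeight (n + 1)) * h2
      + (starWeight (N + 1) * connector (N + 1) (n + 1)) * h3
  rw [pow_succ]
  linear_combination (2 * (-1) ^ n * starWeight (n + 1) ^ s) * h4

theorem alternatingSum_succ (s N : ℕ) :
    alternatingSum (s + 1) N = ∑ m ∈ range N, starWeight (m + 1) * alternatingSum s (m + 1) := by
  induction N with
  | zero => simp [alternatingSum]
  | succ N ih => rw [alternatingSum_succ_sub, ih, sum_range_succ]

theorem monotone_snoc_iff {n : ℕ} (m : Fin n → ℕ) (a : ℕ) :
    Monotone (Fin.snoc m a : Fin (n + 1) → ℕ) ↔ Monotone m ∧ ∀ i, m i ≤ a := by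
  constructor
  · intro h
    refine ⟨fun i j hij => ?_, fun i => ?_⟩
    · simpa using h (Fin.castSucc_le_castSucc_iff.2 hij)
    · simpa using h (Fin.le_last i.castSucc)
  · rintro ⟨h, h'⟩ i j
    refine Fin.lastCases ?_ (fun j => ?_) j <;> refine Fin.lastCases ?_ (fun i => ?_) i
    · simp
    · simp [h']
    · intro hij
      exact absurd hij (not_le.2 (Fin.castSucc_lt_last j))
    · intro hij
      simpa using h (Fin.castSucc_le_castSucc_iff.1 hij)

open Classical in
theorem alternatingSum_eq_sum_monotone (t N : ℕ) :
    alternatingSum (t + 1) N = ∑ m ∈ Fintype.piFinset fun _ : Fin (t + 1) => range N,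
      if Monotone m then headWeight (m 0 + 1) * ∏ j, starWeight (m j + 1) else 0 := by
  induction t generalizing N with
  | zero =>
    rw [alternatingSum_succ]
    refine sum_bij' (fun a _ => fun _ => a) (fun m _ => m 0) ?_ ?_ ?_ ?_ ?_
    · simp
    · simp
    · simp
    · intro m _
      ext j
      rw [Fin.fin_one_eq_zero j]
    · intro a _
      rw [if_pos monotone_const, alternatingSum_zero (Nat.succ_ne_zero a)]
      simp [mul_comm]
  | succ t ih =>
    rw [alternatingSum_succ]
    have key : ∀ a ∈ range N, starWeight (a + 1) * alternatingSum (t + 1) (a + 1) =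
        ∑ m ∈ Fintype.piFinset fun _ : Fin (t + 1) => range N,
          if Monotone m ∧ ∀ i, m i ≤ a then
            headWeight (m 0 + 1) * (∏ j, starWeight (m j + 1)) * starWeight (a + 1) else 0 := by
      intro a ha
      rw [ih, mul_sum]
      refine sum_subset_zero_on_sdiff ?_ ?_ ?_
      · exact Fintype.piFinset_subset _ _ fun _ => range_subset_range.2 (mem_range.1 ha)
      · intro m hm
        rw [if_neg]
        rintro ⟨-, h⟩
        refine (mem_sdiff.1 hm).2 (Fintype.mem_piFinset.2 fun i => ?_)
        exact mem_range.2 (Nat.lt_succ_of_le (h i))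
      · intro m hm
        have h : ∀ i, m i ≤ a := fun i =>
          Nat.le_of_lt_succ (mem_range.1 (Fintype.mem_piFinset.1 hm i))
        simp only [h, implies_true, and_true]
        split_ifs
        · ring
        · simp
    rw [sum_congr rfl key, ← sum_product']
    refine sum_bij' (fun p _ => Fin.snoc p.2 p.1) (fun m _ => (m (Fin.last _), Fin.init m))
      ?_ ?_ ?_ ?_ ?_
    · intro p hp
      rw [mem_product, Fintype.mem_piFinset] at hp
      rw [Fintype.mem_piFinset]
      intro j
      refine Fin.lastCases ?_ (fun j => ?_) j
      · simpa using hp.1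
      · simpa using hp.2 j
    · intro m hm
      rw [Fintype.mem_piFinset] at hm
      exact mem_product.2 ⟨hm _, Fintype.mem_piFinset.2 fun j => hm _⟩
    · simp
    · simp
    · intro p _
      simp only [monotone_snoc_iff, Fin.prod_univ_castSucc (n := t + 1), Fin.snoc_castSucc,
        Fin.snoc_last]
      have h0 : (Fin.snoc p.2 p.1 : Fin (t + 1 + 1) → ℕ) 0 = p.2 0 :=
        Fin.snoc_castSucc (α := fun _ => ℕ) p.1 p.2 0
      rw [h0]
      simp [mul_assoc]

theorem coeff_connector_factor (N n k : ℕ) :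
    coeff k (((N : ℝ⟦X⟧) - (n : ℝ⟦X⟧)) * geomSeries 2 (N + n + 1)) =
      ((N : ℝ) - n) * (2 ^ k / ((N : ℝ) + n + 1) ^ (k + 1)) := by
  rw [← map_natCast (C (R := ℝ)), ← map_natCast (C (R := ℝ)), ← map_sub, coeff_C_mul]
  simp [geomSeries]

theorem abs_coeff_connector_le (N n k : ℕ) : |coeff k (connector N n)| ≤ 2 ^ k := by
  induction n generalizing k with
  | zero =>
    simp only [connector, range_zero, prod_empty, coeff_one]
    split_ifs with h
    · simp [h]
    · simp
  | succ n ih =>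
    have hB : (0 : ℝ) < N + n + 1 := by positivity
    have hsum (k : ℕ) : ∑ q ∈ range (k + 1), ((N : ℝ) + n) / ((N : ℝ) + n + 1) ^ (q + 1) =
        1 - 1 / ((N : ℝ) + n + 1) ^ (k + 1) := by
      induction k with
      | zero => simp; field_simp; ring
      | succ k ih => rw [sum_range_succ, ih]; field_simp; ring
    rw [connector_succ_right, mul_comm, coeff_mul, Nat.sum_antidiagonal_eq_sum_range_succ_mk]
    calc _ ≤ ∑ q ∈ range (k + 1), 2 ^ k * (((N : ℝ) + n) / ((N : ℝ) + n + 1) ^ (q + 1)) := by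
          refine (abs_sum_le_sum_abs _ _).trans (sum_le_sum fun q hq => ?_)
          have hq : q ≤ k := Nat.le_of_lt_succ (mem_range.1 hq)
          have h1 : |(N : ℝ) - n| ≤ N + n := by
            rw [abs_le]
            constructor <;> linarith [(Nat.cast_nonneg N : (0 : ℝ) ≤ N),
              (Nat.cast_nonneg n : (0 : ℝ) ≤ n)]
          dsimp only
          rw [coeff_connector_factor, abs_mul, abs_mul, abs_of_pos (a := 2 ^ q / _) (by positivity)]
          calc _ ≤ ((N : ℝ) + n) * (2 ^ q / ((N : ℝ) + n + 1) ^ (q + 1)) * 2 ^ (k - q) := by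
                gcongr
                exact ih _
            _ = _ := by
                rw [← pow_sub_mul_pow (2 : ℝ) hq]
                ring
      _ ≤ 2 ^ k := by
          rw [← mul_sum, hsum]
          have : 0 ≤ 1 / ((N : ℝ) + n + 1) ^ (k + 1) := by positivity
          nlinarith [pow_pos (two_pos : (0 : ℝ) < 2) k]

open Filter Topology in
theorem tendsto_coeff_mul {f g : ℕ → ℝ⟦X⟧} {F G : ℝ⟦X⟧}
    (hf : ∀ k, Tendsto (fun N => coeff k (f N)) atTop (𝓝 (coeff k F)))
    (hg : ∀ k, Tendsto (fun N => coeff k (g N)) atTop (𝓝 (coeff k G))) (k : ℕ) :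
    Tendsto (fun N => coeff k (f N * g N)) atTop (𝓝 (coeff k (F * G))) := by
  simp only [coeff_mul]
  exact tendsto_finsetSum _ fun p _ => (hf _).mul (hg _)

open Filter Topology in
theorem tendsto_coeff_connector (n k : ℕ) :
    Tendsto (fun N => coeff k (connector N n)) atTop (𝓝 (coeff k (1 : ℝ⟦X⟧))) := by
  induction n generalizing k with
  | zero => simp [connector]
  | succ n ih =>
    rw [← mul_one (1 : ℝ⟦X⟧)]
    simp only [connector_succ_right]
    refine tendsto_coeff_mul ih (fun q => ?_) k
    have hinv : Tendsto (fun N : ℕ => 1 / ((N : ℝ) + n + 1)) atTop (𝓝 0) := by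
      have h := tendsto_one_div_add_atTop_nhds_zero_nat (𝕜 := ℝ)
      refine (h.comp (tendsto_add_atTop_nat n)).congr fun N => ?_
      simp
    have hcoeff (N : ℕ) : ((N : ℝ) - n) * (2 ^ q / ((N : ℝ) + n + 1) ^ (q + 1)) =
        (1 - (2 * n + 1) * (1 / ((N : ℝ) + n + 1))) * (2 * (1 / ((N : ℝ) + n + 1))) ^ q := by
      have hB : (0 : ℝ) < N + n + 1 := by positivity
      simp only [mul_pow, one_div, inv_pow]
      field_simp
      ring
    simp only [coeff_connector_factor, hcoeff]
    have hlim := ((hinv.const_mul (2 * (n : ℝ) + 1)).const_sub 1).mul ((hinv.const_mul 2).pow q)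
    convert hlim using 2
    rw [coeff_one]
    split_ifs with h
    · simp [h]
    · simp [h]

theorem coeff_starWeight_pow (t m k : ℕ) :
    coeff k (starWeight m ^ (t + 1)) =
      2 ^ k * (k + t).choose k * (1 / (m : ℝ) ^ (k + 2 * (t + 1))) := by
  have h : starWeight m = C (1 / (m : ℝ) ^ 2) * rescale (2 / (m : ℝ)) (PowerSeries.mk 1) := by
    ext k
    rw [coeff_C_mul, coeff_rescale]
    simp only [starWeight, coeff_mk, Pi.one_apply, div_pow, mul_one, pow_add]
    rw [div_mul_div_comm, one_mul, mul_comm]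
  rw [h, mul_pow, ← map_pow, ← map_pow, mk_one_pow_eq_mk_choose_add, coeff_C_mul, coeff_rescale,
    coeff_mk, Nat.choose_symm_add (a := t) (b := k), add_comm t k, div_pow, div_pow, one_pow,
    ← pow_mul, pow_add (m : ℝ) k]
  simp only [div_eq_mul_inv, mul_inv]
  ring

open Filter Topology in
theorem tendsto_coeff_alternatingSum (t k : ℕ) :
    Tendsto (fun N => coeff k (alternatingSum (t + 1) N)) atTop
      (𝓝 (∑' n : ℕ, 2 * (-1) ^ n * coeff k (starWeight (n + 1) ^ (t + 1)))) := by
  have hcoeff (N n : ℕ) :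
      coeff k (2 * (-1) ^ n * connector N (n + 1) * starWeight (n + 1) ^ (t + 1)) =
        2 * (-1) ^ n * coeff k (connector N (n + 1) * starWeight (n + 1) ^ (t + 1)) := by
    rw [mul_assoc, ← coeff_C_mul]
    simp [map_ofNat (C (R := ℝ)) 2]
  have hsum (N : ℕ) : coeff k (alternatingSum (t + 1) N) =
      ∑' n : ℕ, 2 * (-1) ^ n * coeff k (connector N (n + 1) * starWeight (n + 1) ^ (t + 1)) := by
    rw [tsum_eq_sum (s := range N), alternatingSum, map_sum]
    · exact sum_congr rfl fun n _ => hcoeff N n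
    · intro n hn
      rw [connector_eq_zero]
      · simp
      · rw [mem_range] at hn
        omega
  simp only [hsum]
  set K : ℝ := ∑ p ∈ antidiagonal k, 2 ^ p.1 * (2 ^ p.2 * (p.2 + t).choose p.2)
  refine tendsto_tsum_of_dominated_convergence
    (bound := fun n : ℕ => 2 * K * (1 / ((n + 1 : ℕ) : ℝ) ^ 2)) ?_ ?_ ?_
  · exact ((summable_nat_add_iff 1).2
      (Real.summable_one_div_nat_pow.2 (by norm_num : 1 < 2))).mul_left _
  · intro n
    refine Tendsto.const_mul _ ?_
    simpa using tendsto_coeff_mul (tendsto_coeff_connector (n + 1))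
      (fun k => tendsto_const_nhds (x := coeff k (starWeight (n + 1) ^ (t + 1)))) k
  · refine Eventually.of_forall fun N n => ?_
    rw [Real.norm_eq_abs, abs_mul, abs_mul, abs_pow, abs_neg, abs_one, one_pow, mul_one, abs_two,
      mul_assoc]
    refine mul_le_mul_of_nonneg_left ?_ zero_le_two
    rw [coeff_mul, sum_mul]
    refine (abs_sum_le_sum_abs _ _).trans (sum_le_sum fun p _ => ?_)
    rw [abs_mul, coeff_starWeight_pow, mul_assoc (2 ^ p.1 : ℝ)]
    refine mul_le_mul (abs_coeff_connector_le _ _ _) ?_ (abs_nonneg _) (by positivity)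
    rw [abs_of_nonneg (by positivity)]
    refine mul_le_mul_of_nonneg_left ?_ (by positivity)
    refine one_div_le_one_div_of_le (by positivity) (pow_le_pow_right₀ ?_ (by omega))
    simp

theorem tsum_alternating_eq_zeta {w : ℕ} (hw : 2 ≤ w) :
    ((∑' n : ℕ, (-1) ^ n * (1 / ((n + 1 : ℕ) : ℝ) ^ w) : ℝ) : ℂ) =
      (1 - 2 * (1 / 2) ^ w) * riemannZeta w := by
  set f : ℕ → ℝ := fun n => 1 / ((n + 1 : ℕ) : ℝ) ^ w with hf
  have hs : Summable f := (summable_nat_add_iff 1).2 (Real.summable_one_div_nat_pow.2 (by omega))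
  have hodd : Summable fun n => f (2 * n + 1) := hs.comp_injective fun a b h => by simpa using h
  have heven : Summable fun n => f (2 * n) := hs.comp_injective fun a b h => by simpa using h
  have hodd_eq : ∑' n, f (2 * n + 1) = (1 / 2) ^ w * ∑' n, f n := by
    rw [← tsum_mul_left]
    refine tsum_congr fun n => ?_
    simp only [hf]
    rw [← one_div_pow, ← one_div_pow, ← mul_pow]
    congr 1
    push_cast
    field_simp
    ring
  have hall := tsum_even_add_odd heven hodd
  have halt : ∑' n : ℕ, (-1) ^ n * f n = ∑' n, f (2 * n) - ∑' n, f (2 * n + 1) := by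
    rw [← tsum_even_add_odd (f := fun n => (-1) ^ n * f n)]
    · simp [pow_succ, pow_mul, tsum_neg, sub_eq_add_neg]
    · simpa [pow_mul] using heven
    · simpa [pow_succ, pow_mul] using hodd.neg
  have hzeta : riemannZeta w = ((∑' n, f n : ℝ) : ℂ) := by
    rw [zeta_nat_eq_tsum_of_gt_one (by omega), Complex.ofReal_tsum, Summable.tsum_eq_zero_add]
    · have : w ≠ 0 := by omega
      simp [hf, this]
    · have := Real.summable_one_div_nat_pow.2 (show 1 < w by omega)
      simpa using Complex.ofRealCLM.summable this
  rw [halt, hzeta]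
  have : ∑' n, f (2 * n) - ∑' n, f (2 * n + 1) = (1 - 2 * (1 / 2) ^ w) * ∑' n, f n := by
    linear_combination hall - 2 * hodd_eq
  rw [this]
  push_cast
  ring

open Filter Topology in
theorem tendsto_sum_box_zetaStar {n : ℕ} (e : Fin n → ℕ) (he : ∀ i, 2 ≤ e i) :
    Tendsto (fun N => ∑ m ∈ Fintype.piFinset fun _ : Fin n => range N,
      if Monotone m then ∏ i, (1 : ℝ) / ((m i + 1 : ℝ) ^ (e i)) else 0) atTop
      (𝓝 (zetaStar e)) := by
  have hmono : Monotone fun N => Fintype.piFinset fun _ : Fin n => range N :=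
    fun N M h => Fintype.piFinset_subset _ _ fun _ => range_subset_range.2 h
  have hmem (m : Fin n → ℕ) : ∃ N, m ∈ Fintype.piFinset fun _ : Fin n => range N :=
    ⟨univ.sup m + 1, Fintype.mem_piFinset.2 fun i =>
      mem_range.2 (Nat.lt_succ_of_le (le_sup (mem_univ i)))⟩
  have htend := tendsto_atTop_finset_of_monotone hmono hmem
  have hS : Summable fun a : ℕ => 1 / ((a : ℝ) + 1) ^ 2 := by
    simpa using (summable_nat_add_iff 1).2
      (Real.summable_one_div_nat_pow.2 (by norm_num : 1 < 2))
  refine (Summable.hasSum ?_).comp htend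
  refine Summable.of_nonneg_of_le (f := fun m : Fin n → ℕ => ∏ i, 1 / ((m i : ℝ) + 1) ^ 2)
    (fun m => ?_) (fun m => ?_) ?_
  · split_ifs <;> positivity
  · split_ifs
    · refine prod_le_prod (fun _ _ => by positivity) fun i _ => ?_
      exact one_div_le_one_div_of_le (by positivity) (pow_le_pow_right₀ (by simp) (he i))
    · positivity
  · refine summable_of_sum_le (c := ∏ _i : Fin n, ∑' a : ℕ, 1 / ((a : ℝ) + 1) ^ 2)
      (fun m => by positivity) fun u => ?_
    obtain ⟨N, hN⟩ := (htend.eventually_ge_atTop u).exists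
    calc _ ≤ ∑ m ∈ Fintype.piFinset fun _ : Fin n => range N, ∏ i, 1 / ((m i : ℝ) + 1) ^ 2 :=
          sum_le_sum_of_subset_of_nonneg hN fun _ _ _ => by positivity
      _ = ∏ _i : Fin n, ∑ a ∈ range N, 1 / ((a : ℝ) + 1) ^ 2 :=
          (prod_univ_sum (fun _ => range N) fun _ a => 1 / ((a : ℝ) + 1) ^ 2).symm
      _ ≤ _ := prod_le_prod (fun _ _ => by positivity) fun _ _ =>
          hS.sum_le_tsum _ fun _ _ => by positivity

theorem coeff_prod_eq_sum_antidiagonalTuple {s : ℕ} (f : Fin s → ℝ⟦X⟧) (l : ℕ) :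
    coeff l (∏ j, f j) = ∑ c ∈ Nat.antidiagonalTuple s l, ∏ j, coeff (c j) (f j) := by
  rw [coeff_prod, ← piAntidiag_univ_fin_eq_antidiagonalTuple, finsuppAntidiag, sum_map,
    ← sum_attach (piAntidiag univ l)]
  rfl

theorem coeff_head_mul_prod_star (t k : ℕ) (m : Fin (t + 1) → ℕ) :
    coeff k (headWeight (m 0 + 1) * ∏ j, starWeight (m j + 1)) =
      ∑ i ∈ range (k + 1), (2 : ℝ) ^ (k - i) * ∑ c ∈ Nat.antidiagonalTuple (t + 1) (k - i),
        ∏ j, (1 : ℝ) / ((m j + 1 : ℝ) ^ (if (j : ℕ) = 0 then i + c j + 2 else c j + 2)) := by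
  rw [coeff_mul, Nat.sum_antidiagonal_eq_sum_range_succ_mk]
  refine sum_congr rfl fun i _ => ?_
  dsimp only
  rw [coeff_prod_eq_sum_antidiagonalTuple, mul_sum, mul_sum]
  refine sum_congr rfl fun c hc => ?_
  rw [← Nat.mem_antidiagonalTuple.1 hc, ← prod_pow_eq_pow_sum, ← prod_mul_distrib,
    Fin.prod_univ_succ, Fin.prod_univ_succ, ← mul_assoc]
  congr 1
  · simp only [headWeight, starWeight, coeff_mk]
    simp
    field_simp
    ring
  · refine prod_congr rfl fun j _ => ?_
    simp [starWeight, div_eq_mul_inv]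

open Classical Filter Topology in
theorem tendsto_coeff_alternatingSum_zetaStar (t k : ℕ) :
    Tendsto (fun N => coeff k (alternatingSum (t + 1) N)) atTop
      (𝓝 (∑ i ∈ range (k + 1), (2 : ℝ) ^ (k - i) *
        ∑ c ∈ Nat.antidiagonalTuple (t + 1) (k - i),
          zetaStar (fun j : Fin (t + 1) => if (j : ℕ) = 0 then i + c j + 2 else c j + 2))) := by
  have h := tendsto_finsetSum (range (k + 1)) fun i _ =>
    (tendsto_finsetSum (Nat.antidiagonalTuple (t + 1) (k - i)) fun c _ =>
      tendsto_sum_box_zetaStar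
        (fun j : Fin (t + 1) => if (j : ℕ) = 0 then i + c j + 2 else c j + 2)
        fun j => by split_ifs <;> omega).const_mul ((2 : ℝ) ^ (k - i))
  refine h.congr fun N => ?_
  rw [alternatingSum_eq_sum_monotone, map_sum]
  simp only [sum_comm (s := Nat.antidiagonalTuple _ _), mul_sum]
  rw [sum_comm]
  refine sum_congr rfl fun m _ => ?_
  split_ifs
  · simp only [coeff_head_mul_prod_star, mul_sum]
  · simp

theorem stmt10 (k s : ℕ) (hs : 1 ≤ s) :
    ((∑ i ∈ Finset.range (k + 1), (2 : ℝ) ^ (k - i) *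
        ∑ c ∈ Finset.Nat.antidiagonalTuple s (k - i),
          zetaStar (fun j : Fin s => if (j : ℕ) = 0 then i + c j + 2 else c j + 2) : ℝ) : ℂ)
    = 2 ^ (1 + k) * (Nat.choose (k + s - 1) k : ℂ)
        * (1 - (2 : ℂ) ^ ((1 : ℤ) - k - 2 * s)) * riemannZeta (k + 2 * s) := by
  obtain ⟨t, rfl⟩ := Nat.exists_eq_add_of_le' hs
  rw [tendsto_nhds_unique (tendsto_coeff_alternatingSum_zetaStar t k)
    (tendsto_coeff_alternatingSum t k)]
  have hterm (n : ℕ) : (2 : ℝ) * (-1) ^ n * coeff k (starWeight (n + 1) ^ (t + 1)) =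
      2 ^ (1 + k) * (k + t).choose k *
        ((-1) ^ n * (1 / ((n + 1 : ℕ) : ℝ) ^ (k + 2 * (t + 1)))) := by
    rw [coeff_starWeight_pow, pow_add]
    ring
  have hpow : (2 : ℂ) ^ ((1 : ℤ) - k - 2 * ((t + 1 : ℕ) : ℤ)) =
      2 * (1 / 2) ^ (k + 2 * (t + 1)) := by
    rw [show (1 : ℤ) - k - 2 * ((t + 1 : ℕ) : ℤ) = 1 - ((k + 2 * (t + 1) : ℕ) : ℤ) by
      push_cast; ring, zpow_sub₀ two_ne_zero, zpow_one, zpow_natCast]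
    simp [div_eq_mul_inv]
  have hzeta := tsum_alternating_eq_zeta (w := k + 2 * (t + 1)) (by omega)
  rw [tsum_congr hterm, tsum_mul_left, Complex.ofReal_mul, hzeta, hpow, ← add_assoc k t 1,
    Nat.add_sub_cancel]
  push_cast
  ring
end

section
/- For every integer r ≥ 0, the alternating multiple series Σ_{i=0}^{r} (-1)^{r-i} (δ_{i0}+1) ζ₋({1}^{r-i}, 2+i) together with the identity ζ*(r+2) = ζ(r+2) yields: Σ_{r₁+⋯+r₁ = r} ζ*(r+2) = ζ(r+2); more generally, for r ≥ 0 and s = 1 the sum (3) of Theorem 1 equals ζ(r+2), a ℚ-polynomial in a single Riemann zeta value. -/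
open scoped BigOperators

/-- Alternating multiple zeta value ζ₋, encoded with mᵢ = m i + 1. -/
noncomputable def zetaMinus {n : ℕ} (k : Fin (n + 1) → ℕ) : ℝ :=
  ∑' m : Fin (n + 1) → ℕ, if StrictMono m then
    (-1 : ℝ) ^ (m (Fin.last n)) * ∏ i, (1 : ℝ) / ((m i + 1 : ℝ) ^ (k i)) else 0

section FiniteIdentity

open PowerSeries

/-- The elementary symmetric polynomial of degree `n` in `1, 1/2, …, 1/N`. -/
noncomputable def harmonicEsymm : ℕ → ℕ → ℝ
  | 0, _ => 1
  | n + 1, N => ∑ M ∈ Finset.range N, harmonicEsymm n M / (M + 1)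

/-- The power series of `1 / (1 - X / (k + 1))`. -/
noncomputable def geomFactor (k : ℕ) : ℝ⟦X⟧ := PowerSeries.mk fun i => ((k : ℝ) + 1)⁻¹ ^ i

/-- The product of `1 - X / m` over `1 ≤ m ≤ N`. -/
noncomputable def linearProd (N : ℕ) : ℝ⟦X⟧ :=
  ∏ m ∈ Finset.range N, (1 - C ((m : ℝ) + 1)⁻¹ * X)

theorem harmonicEsymm_nonneg (n N : ℕ) : 0 ≤ harmonicEsymm n N := by
  induction n generalizing N with
  | zero => simp [harmonicEsymm]
  | succ n ih =>
    rw [harmonicEsymm]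
    exact Finset.sum_nonneg fun M _ => div_nonneg (ih M) (by positivity)

theorem coeff_linearProd (r N : ℕ) :
    coeff r (linearProd N) = (-1) ^ r * harmonicEsymm r N := by
  induction N generalizing r with
  | zero => cases r <;> simp [linearProd, harmonicEsymm, coeff_one]
  | succ N ih =>
    have h : linearProd (N + 1) = linearProd N - C ((N : ℝ) + 1)⁻¹ * (linearProd N * X) := by
      rw [linearProd, Finset.prod_range_succ, ← linearProd]
      ring
    rw [h, map_sub, coeff_C_mul, ih]
    cases r with
    | zero => simp [harmonicEsymm]
    | succ r =>
      rw [coeff_succ_mul_X, ih]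
      simp only [harmonicEsymm, Finset.sum_range_succ]
      ring

theorem X_mul_geomFactor (k : ℕ) :
    X * geomFactor k = C ((k : ℝ) + 1) * geomFactor k - C ((k : ℝ) + 1) := by
  ext i
  have hk : (k : ℝ) + 1 ≠ 0 := by positivity
  cases i with
  | zero => simp [geomFactor]
  | succ i =>
    simp only [map_sub, coeff_succ_X_mul, coeff_C_mul, geomFactor, coeff_mk, coeff_C]
    rw [pow_succ]
    simp [field]

theorem cast_choose_succ_mul {k N : ℕ} (h : N ≤ k) :
    (k.choose (N + 1) : ℝ) * (N + 1) = k.choose N * (k - N) := by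
  have := Nat.choose_succ_right_eq k N
  rw [← Nat.cast_sub h]
  exact_mod_cast this

theorem sum_Ico_inv_mul_choose {N K : ℕ} (h : N + 1 ≤ K) :
    ∑ k ∈ Finset.Ico (N + 1) K, 1 / (((k : ℝ) + 1) * (N + 1) * k.choose (N + 1))
      = 1 / ((N : ℝ) + 1) ^ 2 - 1 / (((N : ℝ) + 1) ^ 2 * K.choose (N + 1)) := by
  induction K, h using Nat.le_induction with
  | base => simp
  | succ K hK ih =>
    rw [Finset.sum_Ico_succ_top hK, ih]
    have h1 : (K.choose (N + 1) : ℝ) ≠ 0 := by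
      exact_mod_cast (Nat.choose_pos hK).ne'
    have h2 : ((K + 1).choose (N + 1) : ℝ) ≠ 0 := by
      exact_mod_cast (Nat.choose_pos (by omega : N + 1 ≤ K + 1)).ne'
    have h3 : (K.choose (N + 1) : ℝ) * (K + 1) = (K + 1).choose (N + 1) * (K - N) := by
      have := Nat.choose_mul_succ_eq K (N + 1)
      rw [← Nat.cast_sub (by omega : N ≤ K), show K - N = K + 1 - (N + 1) by omega]
      exact_mod_cast this
    have hN : (N : ℝ) + 1 ≠ 0 := by positivity
    have hK' : (K : ℝ) + 1 ≠ 0 := by positivity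
    field_simp
    linear_combination h3

/-- `∑_{N ≤ k < K} 1 / ((k + 1) (k + 1 - X) binom(k, N))`. -/
noncomputable def binomialTail (K N : ℕ) : ℝ⟦X⟧ :=
  ∑ k ∈ Finset.Ico N K, C (1 / (((k : ℝ) + 1) ^ 2 * k.choose N)) * geomFactor k

theorem binomialTail_add {N K : ℕ} (h : N < K) :
    binomialTail K N + (1 - C ((N : ℝ) + 1)⁻¹ * X) * binomialTail K (N + 1)
      = C (1 / ((N : ℝ) + 1) ^ 2) * geomFactor N + C (1 / ((N : ℝ) + 1) ^ 2)
        - C (1 / (((N : ℝ) + 1) ^ 2 * K.choose (N + 1))) := by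
  rw [binomialTail, binomialTail, Finset.sum_eq_sum_Ico_succ_bot h, add_assoc, Finset.mul_sum,
    ← Finset.sum_add_distrib, add_sub_assoc, ← map_sub, ← sum_Ico_inv_mul_choose h, map_sum]
  congr 1
  · simp
  refine Finset.sum_congr rfl fun k hk => ?_
  obtain ⟨hNk, -⟩ := Finset.mem_Ico.mp hk
  have h1 : (k.choose (N + 1) : ℝ) ≠ 0 := by exact_mod_cast (Nat.choose_pos hNk).ne'
  have h2 : (k.choose N : ℝ) ≠ 0 := by
    exact_mod_cast (Nat.choose_pos (by omega : N ≤ k)).ne'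
  have h3 := cast_choose_succ_mul (by omega : N ≤ k)
  have hN : (N : ℝ) + 1 ≠ 0 := by positivity
  have hk' : (k : ℝ) + 1 ≠ 0 := by positivity
  have e1 : 1 / (((k : ℝ) + 1) ^ 2 * k.choose N) + 1 / (((k : ℝ) + 1) ^ 2 * k.choose (N + 1))
      - ((N : ℝ) + 1)⁻¹ * (1 / (((k : ℝ) + 1) ^ 2 * k.choose (N + 1))) * (k + 1) = 0 := by
    field_simp
    linear_combination h3
  have e2 : 1 / (((k : ℝ) + 1) * (N + 1) * k.choose (N + 1))
      = ((N : ℝ) + 1)⁻¹ * (1 / (((k : ℝ) + 1) ^ 2 * k.choose (N + 1))) * (k + 1) := by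
    field_simp
  have e1' := congrArg (C (R := ℝ)) e1
  have hX := X_mul_geomFactor k
  rw [e2]
  simp only [map_sub, map_add, map_mul, map_zero] at e1' hX ⊢
  linear_combination geomFactor k * e1' - C ((N : ℝ) + 1)⁻¹
    * C (1 / (((k : ℝ) + 1) ^ 2 * k.choose (N + 1))) * hX

theorem sum_geomFactor (K : ℕ) :
    ∑ k ∈ Finset.range K, C (1 / ((k : ℝ) + 1) ^ 2) * geomFactor k
      = ∑ N ∈ Finset.range K, (-1) ^ N * linearProd N *
        (C (1 / ((N : ℝ) + 1) ^ 2) * geomFactor N + C (1 / ((N : ℝ) + 1) ^ 2)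
          - C (1 / (((N : ℝ) + 1) ^ 2 * K.choose (N + 1)))) := by
  have hstep : ∀ N ∈ Finset.range K, (-1) ^ N * linearProd N *
        (C (1 / ((N : ℝ) + 1) ^ 2) * geomFactor N + C (1 / ((N : ℝ) + 1) ^ 2)
          - C (1 / (((N : ℝ) + 1) ^ 2 * K.choose (N + 1))))
      = (-1) ^ N * linearProd N * binomialTail K N
        - (-1) ^ (N + 1) * linearProd (N + 1) * binomialTail K (N + 1) := by
    intro N hN
    rw [← binomialTail_add (Finset.mem_range.mp hN), linearProd, linearProd,
      Finset.prod_range_succ]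
    ring
  rw [Finset.sum_congr rfl hstep, Finset.sum_range_sub']
  simp [linearProd, binomialTail]

theorem coeff_linearProd_mul_geomFactor (r N : ℕ) :
    coeff r (linearProd N * geomFactor N)
      = ∑ i ∈ Finset.range (r + 1),
        (-1) ^ (r - i) * harmonicEsymm (r - i) N * ((N : ℝ) + 1)⁻¹ ^ i := by
  rw [mul_comm, coeff_mul, Finset.Nat.sum_antidiagonal_eq_sum_range_succ_mk]
  refine Finset.sum_congr rfl fun i _ => ?_
  rw [coeff_linearProd, geomFactor, coeff_mk]
  ring

theorem sum_inv_pow_eq (r K : ℕ) :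
    ∑ k ∈ Finset.range K, 1 / ((k : ℝ) + 1) ^ (r + 2)
      = ∑ N ∈ Finset.range K, ∑ i ∈ Finset.range (r + 1),
          (-1) ^ (r - i) * ((if i = 0 then 1 else 0) + 1)
            * ((-1) ^ N * (harmonicEsymm (r - i) N / ((N : ℝ) + 1) ^ (2 + i)))
        - ∑ N ∈ Finset.range K, (-1) ^ N * ((-1) ^ r
            * (harmonicEsymm r N / ((N : ℝ) + 1) ^ 2 / K.choose (N + 1))) := by
  have h := congrArg (coeff r) (sum_geomFactor K)
  rw [map_sum, map_sum] at h
  rw [← Finset.sum_sub_distrib]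
  convert h using 1
  · refine Finset.sum_congr rfl fun k _ => ?_
    rw [coeff_C_mul, geomFactor, coeff_mk, pow_add]
    have : (k : ℝ) + 1 ≠ 0 := by positivity
    simp [field]
  · refine Finset.sum_congr rfl fun N _ => ?_
    have hC : ((-1) ^ N : ℝ⟦X⟧) = C ((-1) ^ N) := by simp
    rw [show (-1) ^ N * linearProd N *
        (C (1 / ((N : ℝ) + 1) ^ 2) * geomFactor N + C (1 / ((N : ℝ) + 1) ^ 2)
          - C (1 / (((N : ℝ) + 1) ^ 2 * K.choose (N + 1))))
        = (C ((-1) ^ N) * (C (1 / ((N : ℝ) + 1) ^ 2) * (linearProd N * geomFactor N))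
          + C ((-1) ^ N) * (C (1 / ((N : ℝ) + 1) ^ 2) * linearProd N)
          - C ((-1) ^ N) * (C (1 / (((N : ℝ) + 1) ^ 2 * K.choose (N + 1))) * linearProd N)) by
        rw [hC]; ring]
    simp only [map_sub, map_add, coeff_C_mul, coeff_linearProd, coeff_linearProd_mul_geomFactor]
    congr 1
    · simp only [mul_add, add_mul, Finset.sum_add_distrib]
      rw [add_comm]
      congr 1
      · simp only [Finset.mul_sum]
        refine Finset.sum_congr rfl fun i _ => ?_
        rw [pow_add]
        have : (N : ℝ) + 1 ≠ 0 := by positivity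
        simp [field]
      · simp
        ring
    · rw [div_div]
      ring

end FiniteIdentity

section Convergence

open Filter Topology

theorem sum_inv_sqrt_le (N : ℕ) :
    ∑ M ∈ Finset.range N, 1 / √((M : ℝ) + 1) ≤ 2 * √(N : ℝ) := by
  induction N with
  | zero => simp
  | succ N ih =>
    rw [Finset.sum_range_succ]
    push_cast
    have h1 : 0 < √((N : ℝ) + 1) := Real.sqrt_pos.mpr (by positivity)
    have h2 := Real.sqrt_nonneg (N : ℝ)
    have s1 := Real.sq_sqrt (by positivity : (0 : ℝ) ≤ (N : ℝ) + 1)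
    have s2 := Real.sq_sqrt (by positivity : (0 : ℝ) ≤ (N : ℝ))
    have : 1 / √((N : ℝ) + 1) ≤ 2 * √((N : ℝ) + 1) - 2 * √(N : ℝ) := by
      rw [div_le_iff₀ h1]
      nlinarith [sq_nonneg (√((N : ℝ) + 1) - √(N : ℝ))]
    linarith

theorem harmonicEsymm_le (n N : ℕ) : harmonicEsymm n N ≤ 2 ^ n * √((N : ℝ) + 1) := by
  induction n generalizing N with
  | zero => simp [harmonicEsymm]
  | succ n ih =>
    rw [harmonicEsymm]
    calc ∑ M ∈ Finset.range N, harmonicEsymm n M / ((M : ℝ) + 1)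
        ≤ ∑ M ∈ Finset.range N, 2 ^ n * (1 / √((M : ℝ) + 1)) := by
          refine Finset.sum_le_sum fun M _ => ?_
          rw [div_le_iff₀ (by positivity)]
          refine (ih M).trans_eq ?_
          rw [mul_assoc, one_div_mul_eq_div, Real.div_sqrt]
      _ ≤ 2 ^ n * (2 * √(N : ℝ)) := by
          rw [← Finset.mul_sum]
          gcongr
          exact sum_inv_sqrt_le N
      _ ≤ 2 ^ (n + 1) * √((N : ℝ) + 1) := by
          rw [pow_succ, mul_assoc]
          gcongr
          linarith

theorem summable_harmonicEsymm_div (n i : ℕ) :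
    Summable fun N : ℕ => harmonicEsymm n N / ((N : ℝ) + 1) ^ (2 + i) := by
  have hs : Summable fun N : ℕ => (2 : ℝ) ^ n * (1 / ((N + 1 : ℕ) : ℝ) ^ (3 / 2 : ℝ)) :=
    (((summable_nat_add_iff 1).mpr
      (Real.summable_one_div_nat_rpow.mpr (by norm_num : (1 : ℝ) < 3 / 2)))).mul_left _
  refine Summable.of_nonneg_of_le
    (fun N => div_nonneg (harmonicEsymm_nonneg n N) (by positivity)) (fun N => ?_) hs
  have h0 : (0 : ℝ) < (N : ℝ) + 1 := by positivity
  calc harmonicEsymm n N / ((N : ℝ) + 1) ^ (2 + i)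
      ≤ (2 ^ n * √((N : ℝ) + 1)) / ((N : ℝ) + 1) ^ 2 := by
        gcongr
        · exact harmonicEsymm_le n N
        · linarith [Nat.cast_nonneg (α := ℝ) N]
        · omega
    _ = 2 ^ n * (1 / ((N + 1 : ℕ) : ℝ) ^ (3 / 2 : ℝ)) := by
        push_cast
        rw [mul_div_assoc, Real.sqrt_eq_rpow, ← Real.rpow_natCast (_ + 1), ← Real.rpow_sub h0,
          one_div (_ ^ _), ← Real.rpow_neg h0.le]
        norm_num

theorem tendsto_sum_harmonicEsymm_div_choose (r : ℕ) :
    Tendsto (fun K : ℕ => ∑ N ∈ Finset.range K, (-1 : ℝ) ^ N * ((-1) ^ r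
      * (harmonicEsymm r N / ((N : ℝ) + 1) ^ 2 / K.choose (N + 1)))) atTop (𝓝 0) := by
  have hnn : ∀ N, 0 ≤ harmonicEsymm r N / ((N : ℝ) + 1) ^ 2 := fun N =>
    div_nonneg (harmonicEsymm_nonneg r N) (by positivity)
  -- outside `range K` the binomial coefficient vanishes, and so does the quotient
  have h := tendsto_tsum_of_dominated_convergence (𝓕 := atTop)
    (f := fun (K N : ℕ) => (-1 : ℝ) ^ N * ((-1) ^ r
      * (harmonicEsymm r N / ((N : ℝ) + 1) ^ 2 / K.choose (N + 1))))
    (g := fun _ => 0) (summable_harmonicEsymm_div r 0) ?_ ?_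
  · rw [tsum_zero] at h
    refine h.congr fun K => tsum_eq_sum fun N hN => ?_
    rw [Nat.choose_eq_zero_of_lt (by simpa [Nat.lt_succ_iff] using hN)]
    simp
  · intro N
    have hc : Tendsto (fun K : ℕ => (K.choose (N + 1) : ℝ)) atTop atTop := by
      refine tendsto_natCast_atTop_atTop.comp ?_
      refine tendsto_atTop_mono' atTop (f₁ := fun K => K - N) ?_ (tendsto_sub_atTop_nat N)
      filter_upwards [eventually_ge_atTop (N + 1)] with K hK
      induction K, hK using Nat.le_induction with
      | base => simp
      | succ K hK ih =>
        rw [Nat.choose_succ_succ']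
        have := Nat.choose_pos (by omega : N ≤ K)
        omega
    simpa using ((hc.const_div_atTop _).const_mul ((-1 : ℝ) ^ r)).const_mul ((-1 : ℝ) ^ N)
  · refine Eventually.of_forall fun K N => ?_
    simp only [norm_mul, norm_pow, norm_neg, norm_one, one_pow, one_mul, add_zero]
    rw [Real.norm_of_nonneg (div_nonneg (hnn N) (by positivity))]
    rcases Nat.eq_zero_or_pos (K.choose (N + 1)) with h0 | h0
    · simpa [h0] using hnn N
    · exact div_le_self (hnn N) (by exact_mod_cast h0)

theorem hasSum_prod_of_nonneg {α β : Type*} {f : α × β → ℝ} {g : α → ℝ} {a : ℝ}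
    (hf : ∀ p, 0 ≤ f p) (hfg : ∀ x, HasSum (fun y => f (x, y)) (g x)) (hg : HasSum g a) :
    HasSum f a := by
  have hs : Summable f := (summable_prod_of_nonneg hf).mpr
    ⟨fun x => (hfg x).summable, by simpa only [(hfg _).tsum_eq] using hg.summable⟩
  have := hs.hasSum.prod_fiberwise hfg
  exact this.unique hg ▸ hs.hasSum

theorem strictMono_snoc_iff {n : ℕ} (m : Fin (n + 1) → ℕ) (N : ℕ) :
    StrictMono (Fin.snoc m N : Fin (n + 2) → ℕ) ↔ StrictMono m ∧ m (Fin.last n) < N := by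
  rw [Fin.strictMono_iff_lt_succ, Fin.strictMono_iff_lt_succ, Fin.forall_fin_succ']
  simp only [Fin.snoc_castSucc, Fin.succ_last, Fin.snoc_last, ← Fin.castSucc_succ]

theorem hasSum_strictMono_snoc (n N : ℕ) :
    HasSum (fun m : Fin n → ℕ => if StrictMono (Fin.snoc m N : Fin (n + 1) → ℕ) then
      ∏ i, 1 / ((m i : ℝ) + 1) else 0) (harmonicEsymm n N) := by
  induction n generalizing N with
  | zero =>
    convert hasSum_unique (β := Fin 0 → ℕ) _ using 1
    simp [harmonicEsymm, Subsingleton.strictMono]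
  | succ n ih =>
    rw [← (Fin.snocEquiv fun _ => ℕ).hasSum_iff]
    refine hasSum_prod_of_nonneg (g := fun M => if M < N then harmonicEsymm n M / (M + 1) else 0)
      (fun p => ?_) (fun M => ?_) ?_
    · dsimp only [Function.comp]
      split_ifs <;> positivity
    · have hsnoc : ∀ m : Fin n → ℕ,
          (Fin.snocEquiv fun _ => ℕ) (M, m) = (Fin.snoc m M : Fin (n + 1) → ℕ) := fun _ => rfl
      simp only [Function.comp, hsnoc, strictMono_snoc_iff, Fin.snoc_last,
        Fin.prod_univ_castSucc, Fin.snoc_castSucc]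
      by_cases hM : M < N
      · simpa [hM, ite_mul, div_eq_mul_inv] using (ih M).mul_right ((M : ℝ) + 1)⁻¹
      · simp [hM, hasSum_zero]
    · rw [harmonicEsymm, ← Finset.sum_congr rfl fun M hM => if_pos (Finset.mem_range.mp hM)]
      exact hasSum_sum_of_ne_finset_zero fun M hM => if_neg (by simpa using hM)

theorem hasSum_zetaMinus (n i : ℕ) :
    HasSum (fun N : ℕ => (-1 : ℝ) ^ N * (harmonicEsymm n N / ((N : ℝ) + 1) ^ (2 + i)))
      (zetaMinus fun j : Fin (n + 1) => if j = Fin.last n then 2 + i else 1) := by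
  obtain ⟨F, hF⟩ : ∃ F : (Fin (n + 1) → ℕ) → ℝ, F = fun m : Fin (n + 1) → ℕ =>
    if StrictMono m then (-1 : ℝ) ^ (m (Fin.last n)) * ∏ j,
      (1 : ℝ) / ((m j + 1 : ℝ) ^ (if j = Fin.last n then 2 + i else 1)) else 0 := ⟨_, rfl⟩
  obtain ⟨P, hP⟩ : ∃ P : ℕ × (Fin n → ℕ) → ℝ, P = fun p =>
    if StrictMono (Fin.snoc p.2 p.1 : Fin (n + 1) → ℕ) then ∏ j, 1 / ((p.2 j : ℝ) + 1) else 0 :=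
    ⟨_, rfl⟩
  obtain ⟨e, hsnoc⟩ : ∃ e : ℕ × (Fin n → ℕ) ≃ (Fin (n + 1) → ℕ),
      ∀ p, e p = (Fin.snoc p.2 p.1 : Fin (n + 1) → ℕ) :=
    ⟨Fin.snocEquiv fun _ => ℕ, fun _ => rfl⟩
  have hfac : ∀ p, (F ∘ e) p
      = (-1 : ℝ) ^ p.1 * (P p / ((p.1 : ℝ) + 1) ^ (2 + i)) := by
    rintro ⟨N, m⟩
    simp only [hF, hP, Function.comp, hsnoc, Fin.snoc_last, Fin.prod_univ_castSucc,
      Fin.snoc_castSucc, if_true, Fin.castSucc_ne_last, if_false, pow_one]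
    split_ifs
    · ring
    · simp
  have hP0 : ∀ p, 0 ≤ P p := fun p => by
    simp only [hP]
    split_ifs <;> positivity
  have hfib : ∀ N, HasSum (fun m => P (N, m) / ((N : ℝ) + 1) ^ (2 + i))
      (harmonicEsymm n N / ((N : ℝ) + 1) ^ (2 + i)) := fun N => by
    simpa only [hP] using (hasSum_strictMono_snoc n N).div_const _
  have habs : Summable fun p => P p / ((p.1 : ℝ) + 1) ^ (2 + i) :=
    (hasSum_prod_of_nonneg (f := fun p => P p / ((p.1 : ℝ) + 1) ^ (2 + i))
      (fun p => div_nonneg (hP0 p) (by positivity)) hfib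
      (summable_harmonicEsymm_div n i).hasSum).summable
  have hnorm : ∀ p, ‖(F ∘ e) p‖ = P p / ((p.1 : ℝ) + 1) ^ (2 + i) := fun p => by
    rw [hfac, norm_mul, norm_pow, norm_neg, norm_one, one_pow, one_mul,
      Real.norm_of_nonneg (div_nonneg (hP0 p) (by positivity))]
  have hs : Summable (F ∘ e) := Summable.of_norm (by simpa only [hnorm] using habs)
  have htsum : HasSum (F ∘ e)
      (zetaMinus fun j : Fin (n + 1) => if j = Fin.last n then 2 + i else 1) := by
    rw [Equiv.hasSum_iff, zetaMinus, ← hF]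
    exact ((Equiv.summable_iff _).mp hs).hasSum
  refine htsum.prod_fiberwise fun N => ?_
  simp only [hfac]
  exact (hfib N).mul_left _

end Convergence

/-- The s = 1 case of the sum (3) of Theorem 1 equals ζ(r+2), a ℚ-polynomial in a single
Riemann zeta value. -/
theorem stmt18 (r : ℕ) :
    ((∑ i ∈ Finset.range (r + 1),
      (-1 : ℝ) ^ (r - i) * (((if i = 0 then 1 else 0) : ℝ) + 1)
        * zetaMinus (fun j : Fin (r - i + 1) => if j = Fin.last (r - i) then 2 + i else 1) : ℝ) : ℂ)
    = riemannZeta (r + 2) := by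
  have hseries := (hasSum_sum fun i (_ : i ∈ Finset.range (r + 1)) =>
    (hasSum_zetaMinus (r - i) i).mul_left
      ((-1 : ℝ) ^ (r - i) * ((if i = 0 then 1 else 0) + 1))).tendsto_sum_nat
  have hlim := hseries.sub (tendsto_sum_harmonicEsymm_div_choose r)
  simp only [← sum_inv_pow_eq, sub_zero] at hlim
  have hzeta : Summable fun k : ℕ => 1 / ((k : ℝ) + 1) ^ (r + 2) := by
    simpa using (summable_nat_add_iff 1).mpr
      (Real.summable_one_div_nat_pow.mpr (by omega : 1 < r + 2))
  rw [tendsto_nhds_unique hlim hzeta.hasSum.tendsto_sum_nat,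
    zeta_eq_tsum_one_div_nat_add_one_cpow (by simp; linarith [Nat.cast_nonneg (α := ℝ) r]),
    Complex.ofReal_tsum]
  refine tsum_congr fun k => ?_
  rw [show (r : ℂ) + 2 = ((r + 2 : ℕ) : ℂ) by push_cast; rfl, Complex.cpow_natCast]
  push_cast
  rfl
end
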